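/- Assume the ball-system setup with filling hypotheses (F1) and (F2), and assume property (*). Let N ≥ 2K and let 𝔹 be a nonempty finite subset of (1/N)𝔅. Define m := 1 + ⌊log_K(𝔯_max(𝔹)/𝔯_min(𝔹))⌋. Let 1 ≤ i ≤ k, let 0 < δ ≤ 𝔯_min(𝔹), and let d be a g^{(m)}(δ)-fine discrete i-chain in 𝒮 such that supp(∂d) is disjoint from every ball in 𝔹 (here g^{(m)} denotes the m-fold composition of g). Then there exists a discrete i-chain d' in 𝒮 such that: (1) d' is δ-fine and ∂d' = ∂d; (2) supp(d') is disjoint from every ball in (1/(2K))𝔹; (3) supp(d') is contained in the closed 8K·𝔯_max(𝔹)-neighbourhood of supp(d); (4) if ∂d ≠ 0, then diam(d') ≤ diam(d) + 8K·√(2K·diam(d)); (5) if moreover d is g^{(m+1)}(δ)-fine, then d − d' = ∂e for a δ-fine discrete (i+1)-chain e supported in the closed (4K²+8K)·𝔯_max(𝔹)-neighbourhood of supp(d). -/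

import Mathlib

/-- Discrete chains with `m` vertices: the free `ℤ`-module on ordered `m`-tuples of points. -/
abbrev DChain (α : Type*) (m : ℕ) := (Fin m → α) →₀ ℤ

/-- The `i`-th face operator on discrete chains, deleting the `i`-th vertex. -/
noncomputable def dface {α : Type*} {m : ℕ} (i : Fin (m + 1)) :
    DChain α (m + 1) →ₗ[ℤ] DChain α m :=
  Finsupp.lmapDomain ℤ ℤ (fun σ => σ ∘ i.succAbove)

/-- The simplicial boundary operator on discrete chains:
`∂[x₀,…,xₙ] = ∑ i, (-1)^i [x₀,…,x̂ᵢ,…,xₙ]`. -/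
noncomputable def dbd {α : Type*} {m : ℕ} : DChain α (m + 1) →ₗ[ℤ] DChain α m :=
  ∑ i : Fin (m + 1), ((-1 : ℤ) ^ (i : ℕ)) • dface i

/-- The chain map induced by a map on vertices. -/
noncomputable def vmap {α β : Type*} (f : α → β) {m : ℕ} : DChain α m →ₗ[ℤ] DChain β m :=
  Finsupp.lmapDomain ℤ ℤ (fun σ => f ∘ σ)

/-- The support of a discrete chain: the set of vertices appearing in its
cancellation-free expression. -/
def chainSupp {α : Type*} {m : ℕ} (c : DChain α m) : Set α :=
  ⋃ σ ∈ c.support, Set.range σ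
/-- A discrete chain is `δ`-fine if each of its simplices has diameter at most `δ`. -/
def FineLE {X : Type*} [PseudoMetricSpace X] {m : ℕ} (δ : ℝ) (c : DChain X m) : Prop :=
  ∀ σ ∈ c.support, Metric.diam (Set.range σ) ≤ δ

/-- The closed annulus `A(p; r₁, r₂)` around `p`. -/
def annulus {X : Type*} [PseudoMetricSpace X] (p : X) (r₁ r₂ : ℝ) : Set X :=
  {x | r₁ ≤ dist p x ∧ dist p x ≤ r₂}

/-- Filling hypothesis (F1): reduced `g(δ)`-fine discrete `i`-cycles (`0 ≤ i < k`) supported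
in an annulus `A(p; r₁, r₂)` with `δ ≤ r₁ < r₂ ≤ r_p/K` around a point `p ∈ P` bound
`δ`-fine chains in `A(p; r₁/K, K·r₂)` of diameter at most `K·√(diam c)`. -/
def FillAnnuli {𝒮 : Type*} [MetricSpace 𝒮] (k : ℕ) (K : ℝ) (g : ℝ → ℝ)
    (P : Set 𝒮) (r : 𝒮 → ℝ) : Prop :=
  ∀ p ∈ P, ∀ δ : ℝ, 0 < δ → ∀ i : ℕ, i < k → ∀ r₁ r₂ : ℝ, δ ≤ r₁ → r₁ < r₂ → r₂ ≤ r p / K →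
    ∀ c : DChain 𝒮 (i + 1), dbd c = 0 → FineLE (g δ) c → chainSupp c ⊆ annulus p r₁ r₂ →
      ∃ d : DChain 𝒮 (i + 2), dbd d = c ∧ FineLE δ d ∧
        chainSupp d ⊆ annulus p (r₁ / K) (K * r₂) ∧
        Metric.diam (chainSupp d) ≤ K * Real.sqrt (Metric.diam (chainSupp c))

/-- Filling hypothesis (F2): reduced `g(δ)`-fine discrete `i`-cycles (`0 ≤ i ≤ k`) supported
in a ball `B(p, r₂)` with `0 < r₂ ≤ r_p/K` around a point `p ∈ P` bound `δ`-fine chains in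
`B(p, K·r₂)` of diameter at most `K·√(diam c)`. -/
def FillBalls {𝒮 : Type*} [MetricSpace 𝒮] (k : ℕ) (K : ℝ) (g : ℝ → ℝ)
    (P : Set 𝒮) (r : 𝒮 → ℝ) : Prop :=
  ∀ p ∈ P, ∀ δ : ℝ, 0 < δ → ∀ i : ℕ, i ≤ k → ∀ r₂ : ℝ, 0 < r₂ → r₂ ≤ r p / K →
    ∀ c : DChain 𝒮 (i + 1), dbd c = 0 → FineLE (g δ) c →
      chainSupp c ⊆ Metric.closedBall p r₂ →
      ∃ d : DChain 𝒮 (i + 2), dbd d = c ∧ FineLE δ d ∧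
        chainSupp d ⊆ Metric.closedBall p (K * r₂) ∧
        Metric.diam (chainSupp d) ≤ K * Real.sqrt (Metric.diam (chainSupp c))

/-- The closed `r`-neighbourhood of a set. -/
def closedNbhd {X : Type*} [PseudoMetricSpace X] (r : ℝ) (s : Set X) : Set X :=
  {y | ∃ z ∈ s, dist y z ≤ r}

theorem mem_chainSupp {α : Type*} {m : ℕ} {c : DChain α m} {x : α} :
    x ∈ chainSupp c ↔ ∃ σ ∈ c.support, ∃ a, σ a = x := by
  simp only [chainSupp, Set.mem_iUnion, Set.mem_range, exists_prop]

theorem chainSupp_subset_iff {α : Type*} {m : ℕ} {c : DChain α m} {S : Set α} :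
    chainSupp c ⊆ S ↔ c ∈ Finsupp.supported ℤ ℤ {σ : Fin m → α | Set.range σ ⊆ S} := by
  rw [Finsupp.mem_supported, chainSupp, Set.iUnion₂_subset_iff]
  rfl

theorem fineLE_iff {X : Type*} [PseudoMetricSpace X] {m : ℕ} {δ : ℝ} {c : DChain X m} :
    FineLE δ c ↔ c ∈ Finsupp.supported ℤ ℤ {σ : Fin m → X | Metric.diam (Set.range σ) ≤ δ} := by
  rw [Finsupp.mem_supported]
  rfl

theorem FineLE.mono {X : Type*} [PseudoMetricSpace X] {m : ℕ} {δ δ' : ℝ} {c : DChain X m}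
    (hc : FineLE δ c) (h : δ ≤ δ') : FineLE δ' c :=
  fun σ hσ => (hc σ hσ).trans h

@[simp] theorem chainSupp_zero {α : Type*} {m : ℕ} : chainSupp (0 : DChain α m) = ∅ := by
  simp [chainSupp]

theorem fineLE_zero {X : Type*} [PseudoMetricSpace X] {m : ℕ} (δ : ℝ) :
    FineLE δ (0 : DChain X m) := by
  simp [FineLE]

theorem chainSupp_finite {α : Type*} {m : ℕ} (c : DChain α m) : (chainSupp c).Finite :=
  c.support.finite_toSet.biUnion fun σ _ => Set.finite_range σ

theorem FineLE.dist_le {X : Type*} [PseudoMetricSpace X] {m : ℕ} {δ : ℝ} {c : DChain X m}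
    (hc : FineLE δ c) {σ : Fin m → X} (hσ : σ ∈ c.support) (a b : Fin m) :
    dist (σ a) (σ b) ≤ δ :=
  (Metric.dist_le_diam_of_mem (Set.finite_range σ).isBounded ⟨a, rfl⟩ ⟨b, rfl⟩).trans (hc σ hσ)

theorem dface_single {α : Type*} {m : ℕ} (a : Fin (m + 1)) (σ : Fin (m + 1) → α) (n : ℤ) :
    dface a (Finsupp.single σ n) = Finsupp.single (σ ∘ a.succAbove) n := by
  simp [dface, Finsupp.lmapDomain_apply, Finsupp.mapDomain_single]

theorem exists_face_of_mem_support_dbd {α : Type*} {m : ℕ} {c : DChain α (m + 1)}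
    {τ : Fin m → α} (hτ : τ ∈ (dbd c).support) :
    ∃ σ ∈ c.support, ∃ a : Fin (m + 1), τ = σ ∘ a.succAbove := by
  have h : dbd c ∈ Finsupp.supported ℤ ℤ
      {τ : Fin m → α | ∃ σ ∈ c.support, ∃ a : Fin (m + 1), τ = σ ∘ a.succAbove} := by
    simp only [dbd, LinearMap.sum_apply, LinearMap.smul_apply]
    refine Submodule.sum_mem _ fun a _ => Submodule.smul_mem _ _ ?_
    rw [Finsupp.mem_supported, dface, Finsupp.lmapDomain_apply]
    classical
    intro τ hτ
    obtain ⟨σ, hσ, rfl⟩ := Finset.mem_image.1 (Finsupp.mapDomain_support hτ)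
    exact ⟨σ, hσ, a, rfl⟩
  exact (Finsupp.mem_supported _ _).1 h hτ

theorem chainSupp_dbd_subset {α : Type*} {m : ℕ} (c : DChain α (m + 1)) :
    chainSupp (dbd c) ⊆ chainSupp c := by
  intro x hx
  obtain ⟨τ, hτ, a, rfl⟩ := mem_chainSupp.1 hx
  obtain ⟨σ, hσ, b, rfl⟩ := exists_face_of_mem_support_dbd hτ
  exact mem_chainSupp.2 ⟨σ, hσ, _, rfl⟩

theorem FineLE.dbd {X : Type*} [PseudoMetricSpace X] {m : ℕ} {δ : ℝ} {c : DChain X (m + 1)}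
    (hc : FineLE δ c) : FineLE δ (dbd c) := by
  intro τ hτ
  obtain ⟨σ, hσ, b, rfl⟩ := exists_face_of_mem_support_dbd hτ
  exact (Metric.diam_mono (Set.range_comp_subset_range _ _)
    (Set.finite_range σ).isBounded).trans (hc σ hσ)

/-- The cone operator on discrete chains, inserting `x` as a new initial vertex. -/
noncomputable def dcone {α : Type*} {m : ℕ} (x : α) : DChain α m →ₗ[ℤ] DChain α (m + 1) :=
  Finsupp.lmapDomain ℤ ℤ fun σ => (Fin.cons x σ : Fin (m + 1) → α)

theorem dcone_single {α : Type*} {m : ℕ} (x : α) (σ : Fin m → α) (n : ℤ) :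
    dcone x (Finsupp.single σ n) = Finsupp.single (Fin.cons x σ : Fin (m + 1) → α) n := by
  simp [dcone, Finsupp.lmapDomain_apply, Finsupp.mapDomain_single]

theorem dface_zero_comp_dcone {α : Type*} {m : ℕ} (x : α) :
    (dface 0).comp (dcone x) = (LinearMap.id : DChain α m →ₗ[ℤ] DChain α m) := by
  ext σ : 2
  simp only [LinearMap.comp_apply, Finsupp.lsingle_apply, dcone_single, dface_single,
    LinearMap.id_apply]
  congr 1

theorem dface_succ_comp_dcone {α : Type*} {m : ℕ} (x : α) (a : Fin (m + 1)) :
    (dface a.succ).comp (dcone x) =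
      ((dcone x).comp (dface a) : DChain α (m + 1) →ₗ[ℤ] DChain α (m + 1)) := by
  ext σ : 2
  simp only [LinearMap.comp_apply, Finsupp.lsingle_apply, dcone_single, dface_single]
  congr 1
  funext b
  refine Fin.cases ?_ (fun b => ?_) b <;> simp

theorem dbd_dcone {α : Type*} {m : ℕ} (x : α) (c : DChain α (m + 1)) :
    dbd (dcone x c) = c - dcone x (dbd c) := by
  have h0 := LinearMap.congr_fun (dface_zero_comp_dcone x) c
  have h1 := fun a => LinearMap.congr_fun (dface_succ_comp_dcone x a) c
  simp only [LinearMap.comp_apply, LinearMap.id_apply] at h0 h1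
  simp only [dbd, LinearMap.sum_apply, LinearMap.smul_apply]
  rw [Fin.sum_univ_succ, map_sum]
  simp [h0, h1, pow_succ, sub_eq_add_neg]

theorem dbd_dcone_zero {α : Type*} (x : α) (c : DChain α 0) : dbd (dcone x c) = c := by
  simpa [dbd] using LinearMap.congr_fun (dface_zero_comp_dcone x) c

theorem dbd_dbd {α : Type*} {m : ℕ} (c : DChain α (m + 2)) : dbd (dbd c) = 0 := by
  induction m with
  | zero =>
    induction c using Finsupp.induction_linear with
    | zero => simp
    | add f g hf hg => simp [hf, hg]
    | single σ n =>
      rw [← Fin.cons_self_tail σ, ← dcone_single, dbd_dcone, map_sub, dbd_dcone_zero, sub_self]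
  | succ m ih =>
    induction c using Finsupp.induction_linear with
    | zero => simp
    | add f g hf hg => simp [hf, hg]
    | single σ n =>
      rw [← Fin.cons_self_tail σ, ← dcone_single, dbd_dcone, map_sub, dbd_dcone, ih]
      simp

open Classical in
/-- The part of a chain consisting of the simplices with a vertex in the closed ball
`B(p, R)`. -/
noncomputable def ballPart {X : Type*} [PseudoMetricSpace X] {m : ℕ} (p : X) (R : ℝ)
    (c : DChain X m) : DChain X m :=
  c.filter fun σ => ∃ a, dist (σ a) p ≤ R

theorem mem_support_ballPart {X : Type*} [PseudoMetricSpace X] {m : ℕ} {p : X} {R : ℝ}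
    {c : DChain X m} {σ : Fin m → X} :
    σ ∈ (ballPart p R c).support ↔ σ ∈ c.support ∧ ∃ a, dist (σ a) p ≤ R := by
  classical
  simp [ballPart, Finsupp.support_filter, -Finsupp.mem_support_iff]

theorem chainSupp_ballPart_subset {X : Type*} [PseudoMetricSpace X] {m : ℕ} (p : X) (R : ℝ)
    (c : DChain X m) : chainSupp (ballPart p R c) ⊆ chainSupp c := by
  intro x hx
  obtain ⟨σ, hσ, h⟩ := mem_chainSupp.1 hx
  exact mem_chainSupp.2 ⟨σ, (mem_support_ballPart.1 hσ).1, h⟩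

theorem FineLE.ballPart {X : Type*} [PseudoMetricSpace X] {m : ℕ} {δ : ℝ} {c : DChain X m}
    (hc : FineLE δ c) (p : X) (R : ℝ) : FineLE δ (ballPart p R c) :=
  fun σ hσ => hc σ (mem_support_ballPart.1 hσ).1

theorem FineLE.dist_le_of_mem_ballPart {X : Type*} [PseudoMetricSpace X] {m : ℕ} {δ : ℝ}
    {c : DChain X m} (hc : FineLE δ c) {p x : X} {R : ℝ}
    (hx : x ∈ chainSupp (_root_.ballPart p R c)) : dist x p ≤ δ + R := by
  obtain ⟨σ, hσ, a, rfl⟩ := mem_chainSupp.1 hx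
  obtain ⟨hσ, b, hb⟩ := mem_support_ballPart.1 hσ
  linarith [dist_triangle (σ a) (σ b) p, hc.dist_le hσ a b]

/-- If `∂c` avoids the ball `B(p, R)`, then so does the boundary of the part of `c` meeting
that ball. -/
theorem lt_dist_of_mem_dbd_ballPart {X : Type*} [PseudoMetricSpace X] {m : ℕ} {p : X} {R : ℝ}
    {c : DChain X (m + 1)} (hbd : ∀ x ∈ chainSupp (dbd c), R < dist x p) {x : X}
    (hx : x ∈ chainSupp (dbd (ballPart p R c))) : R < dist x p := by
  classical
  obtain ⟨τ, hτ, a, rfl⟩ := mem_chainSupp.1 hx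
  by_contra! hle
  have hsplit : c = ballPart p R c + c.filter fun σ => ¬ ∃ a, dist (σ a) p ≤ R :=
    (Finsupp.filter_add_filter_not c _).symm
  have h1 : dbd c τ = 0 := by
    by_contra h
    exact hle.not_gt (hbd _ (mem_chainSupp.2 ⟨τ, Finsupp.mem_support_iff.2 h, a, rfl⟩))
  have h2 : dbd (c.filter fun σ => ¬ ∃ a, dist (σ a) p ≤ R) τ = 0 := by
    by_contra h
    obtain ⟨σ, hσ, b, rfl⟩ := exists_face_of_mem_support_dbd (Finsupp.mem_support_iff.2 h)
    rw [Finsupp.support_filter, Finset.mem_filter] at hσ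
    exact hσ.2 ⟨_, hle⟩
  rw [hsplit, map_add, Finsupp.add_apply, h2, add_zero] at h1
  exact Finsupp.mem_support_iff.1 hτ h1

/-- Replacing the part of a chain that meets a single ball by a filling, in an annulus, of the
boundary of that part. -/
theorem detour_ball {𝒮 : Type*} [MetricSpace 𝒮] {k : ℕ} {K : ℝ} (hK : 1 ≤ K)
    {g : ℝ → ℝ} (hg : ∀ δ : ℝ, 0 < δ → 0 < g δ ∧ g δ ≤ δ) {P : Set 𝒮} {r : 𝒮 → ℝ}
    (hF1 : FillAnnuli k K g P r) (hF2 : FillBalls k K g P r) {p : 𝒮} (hp : p ∈ P) {R : ℝ}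
    (hRr : 2 * K * R ≤ r p / K) {j : ℕ} (hj : j + 1 ≤ k) {ε : ℝ} (hε : 0 < ε) (hεR : ε ≤ R)
    {c : DChain 𝒮 (j + 2)} (hc : FineLE (g ε) c)
    (hbd : ∀ x ∈ chainSupp (dbd c), R < dist x p) :
    ∃ f : DChain 𝒮 (j + 2), FineLE ε f ∧ dbd f = dbd (ballPart p R c) ∧
      (∀ x ∈ chainSupp f, R / K ≤ dist x p ∧ dist x p ≤ 2 * K * R ∧
        (∃ y ∈ chainSupp c, dist y p ≤ R) ∧
        ∃ y ∈ chainSupp c, dist x y ≤ 2 * K * √R) ∧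
      ∀ ε₂, 0 < ε₂ → ε = g ε₂ → ∃ e : DChain 𝒮 (j + 3), dbd e = ballPart p R c - f ∧
        FineLE ε₂ e ∧ ∀ x ∈ chainSupp e, dist x p ≤ 2 * K ^ 2 * R ∧
          ∃ y ∈ chainSupp c, dist y p ≤ R := by
  have hR : 0 < R := hε.trans_le hεR
  have hgε := hg ε hε
  by_cases h0 : ballPart p R c = 0
  · refine ⟨0, fineLE_zero _, by rw [h0], by simp, fun ε₂ _ _ => ⟨0, ?_, fineLE_zero _, by simp⟩⟩
    rw [h0]; simp
  obtain ⟨y, hy, hyp⟩ : ∃ y ∈ chainSupp c, dist y p ≤ R := by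
    obtain ⟨σ, hσ⟩ := Finsupp.support_nonempty_iff.2 h0
    obtain ⟨hσ, a, ha⟩ := mem_support_ballPart.1 hσ
    exact ⟨σ a, mem_chainSupp.2 ⟨σ, hσ, a, rfl⟩, ha⟩
  have hball : ∀ x ∈ chainSupp (ballPart p R c), dist x p ≤ 2 * R := fun x hx => by
    linarith [hc.dist_le_of_mem_ballPart hx]
  suffices h : ∃ f : DChain 𝒮 (j + 2), FineLE ε f ∧ dbd f = dbd (ballPart p R c) ∧
      ∀ x ∈ chainSupp f, R / K ≤ dist x p ∧ dist x p ≤ 2 * K * R ∧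
        ∃ y ∈ chainSupp c, dist x y ≤ 2 * K * √R by
    obtain ⟨f, hf, hfbd, hfs⟩ := h
    refine ⟨f, hf, hfbd, fun x hx => ⟨(hfs x hx).1, (hfs x hx).2.1, ⟨y, hy, hyp⟩,
      (hfs x hx).2.2⟩, fun ε₂ hε₂ hεε₂ => ?_⟩
    have hfine : FineLE (g ε₂) (ballPart p R c - f) := by
      rw [fineLE_iff]
      exact Submodule.sub_mem _
        (fineLE_iff.1 ((hc.ballPart p R).mono (hεε₂ ▸ hgε.2))) (fineLE_iff.1 (hεε₂ ▸ hf))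
    have hsupp : chainSupp (ballPart p R c - f) ⊆ Metric.closedBall p (2 * K * R) := by
      rw [chainSupp_subset_iff]
      refine Submodule.sub_mem _ (chainSupp_subset_iff.1 fun x hx => ?_)
        (chainSupp_subset_iff.1 fun x hx => (hfs x hx).2.1)
      exact Metric.mem_closedBall.2 ((hball x hx).trans (by nlinarith))
    obtain ⟨e, he, hef, hes, -⟩ := hF2 p hp ε₂ hε₂ (j + 1) hj (2 * K * R) (by positivity) hRr
      (ballPart p R c - f) (by rw [map_sub, hfbd, sub_self]) hfine hsupp
    refine ⟨e, he, hef, fun x hx => ⟨?_, y, hy, hyp⟩⟩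
    have := Metric.mem_closedBall.1 (hes hx)
    linarith
  by_cases hb0 : dbd (ballPart p R c) = 0
  · exact ⟨0, fineLE_zero _, by simp [hb0], by simp⟩
  obtain ⟨f, hf, hff, hfs, hfd⟩ := hF1 p hp ε hε j hj R (2 * R) hεR (by linarith)
    (le_trans (by nlinarith) hRr) (dbd (ballPart p R c)) (dbd_dbd _) (hc.ballPart p R).dbd
    fun x hx => by
      rw [annulus, Set.mem_ofPred_eq, dist_comm p x]
      exact ⟨(lt_dist_of_mem_dbd_ballPart hbd hx).le, hball x (chainSupp_dbd_subset _ hx)⟩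
  refine ⟨f, hff, hf, fun x hx => ?_⟩
  have hxa := hfs hx
  rw [annulus, Set.mem_ofPred_eq, dist_comm p x] at hxa
  refine ⟨hxa.1, by linarith [hxa.2], ?_⟩
  obtain ⟨τ, hτ⟩ := Finsupp.support_nonempty_iff.2 hb0
  have hz : τ 0 ∈ chainSupp (dbd (ballPart p R c)) := mem_chainSupp.2 ⟨τ, hτ, 0, rfl⟩
  refine ⟨τ 0, chainSupp_ballPart_subset p R c (chainSupp_dbd_subset _ hz), ?_⟩
  have h1 : dist x (τ 0) ≤ Metric.diam (chainSupp f) :=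
    Metric.dist_le_diam_of_mem (chainSupp_finite f).isBounded hx
      (chainSupp_dbd_subset f (hf ▸ hz))
  have h2 : Metric.diam (chainSupp (dbd (ballPart p R c))) ≤ 2 ^ 2 * R := by
    refine Metric.diam_le_of_forall_dist_le (by positivity) fun a ha b hb => ?_
    linarith [dist_triangle_right a b p, hball a (chainSupp_dbd_subset _ ha),
      hball b (chainSupp_dbd_subset _ hb)]
  have h3 := Real.sqrt_le_sqrt h2
  rw [Real.sqrt_mul (by positivity), Real.sqrt_sq (by norm_num)] at h3
  nlinarith [mul_le_mul_of_nonneg_left h3 (by linarith : (0 : ℝ) ≤ K)]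

/-- Simultaneous detour around finitely many well-separated balls. -/
theorem detour_separated_balls {𝒮 : Type*} [MetricSpace 𝒮] {k : ℕ} {K : ℝ} (hK : 1 ≤ K)
    {g : ℝ → ℝ} (hg : ∀ δ : ℝ, 0 < δ → 0 < g δ ∧ g δ ≤ δ) {P : Set 𝒮} {r : 𝒮 → ℝ}
    (hF1 : FillAnnuli k K g P r) (hF2 : FillBalls k K g P r) {ρ : 𝒮 → ℝ} (Q : Finset 𝒮)
    (hQP : ∀ q ∈ Q, q ∈ P) (hρr : ∀ q ∈ Q, 2 * K * ρ q ≤ r q / K)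
    (hsep : ∀ p ∈ Q, ∀ q ∈ Q, p ≠ q → ∀ x, dist x p ≤ 2 * K * ρ p → 2 * K * ρ q < dist x q)
    {j : ℕ} (hj : j + 1 ≤ k) {ε : ℝ} (hε : 0 < ε) (hερ : ∀ q ∈ Q, ε ≤ ρ q)
    {c : DChain 𝒮 (j + 2)} (hc : FineLE (g ε) c)
    (hbd : ∀ q ∈ Q, ∀ x ∈ chainSupp (dbd c), ρ q < dist x q) :
    ∃ c' : DChain 𝒮 (j + 2), FineLE ε c' ∧ dbd c' = dbd c ∧
      (∀ x ∈ chainSupp c', (x ∈ chainSupp c ∧ ∀ q ∈ Q, ρ q < dist x q) ∨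
        ∃ q ∈ Q, ρ q / K ≤ dist x q ∧ dist x q ≤ 2 * K * ρ q ∧
          (∃ y ∈ chainSupp c, dist y q ≤ ρ q) ∧
          ∃ y ∈ chainSupp c, dist x y ≤ 2 * K * √(ρ q)) ∧
      ∀ ε₂, 0 < ε₂ → ε = g ε₂ → ∃ e : DChain 𝒮 (j + 3), dbd e = c - c' ∧ FineLE ε₂ e ∧
        ∀ x ∈ chainSupp e, ∃ q ∈ Q, dist x q ≤ 2 * K ^ 2 * ρ q ∧
          ∃ y ∈ chainSupp c, dist y q ≤ ρ q := by
  classical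
  have hρ : ∀ q ∈ Q, 0 < ρ q := fun q hq => hε.trans_le (hερ q hq)
  have key := fun q : Q => detour_ball hK hg hF1 hF2 (hQP q q.2) (hρr q q.2) hj hε
    (hερ q q.2) hc (hbd q q.2)
  choose f hff hfbd hfs hfe using key
  let rest : DChain 𝒮 (j + 2) := c.filter fun σ => ∀ q ∈ Q, ∀ a, ρ q < dist (σ a) q
  have hrest : ∀ σ ∈ rest.support, σ ∈ c.support ∧ ∀ q ∈ Q, ∀ a, ρ q < dist (σ a) q :=
    fun σ hσ => by rwa [Finsupp.support_filter, Finset.mem_filter] at hσ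
  have hsplit : c = rest + ∑ q : Q, ballPart q.1 (ρ q) c := by
    ext σ
    rw [Finsupp.add_apply, Finsupp.finsetSum_apply]
    by_cases hσ : σ ∈ c.support
    swap
    · simp [rest, ballPart, Finsupp.filter_apply, Finsupp.notMem_support_iff.1 hσ]
    by_cases hall : ∀ q ∈ Q, ∀ a, ρ q < dist (σ a) q
    · have h0 : ∀ q : Q, ballPart q.1 (ρ q) c σ = 0 := fun q =>
        Finsupp.filter_apply_neg _ _ fun ⟨a, ha⟩ => ha.not_gt (hall q q.2 a)
      have h1 : rest σ = c σ := Finsupp.filter_apply_pos _ _ hall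
      simp [h0, h1]
    · have h0 : rest σ = 0 := Finsupp.filter_apply_neg _ _ hall
      push Not at hall
      obtain ⟨q, hq, a, ha⟩ := hall
      rw [h0, zero_add, Finset.sum_eq_single ⟨q, hq⟩ ?_ (by simp)]
      · exact (Finsupp.filter_apply_pos _ _ ⟨a, ha⟩).symm
      · rintro ⟨p, hp⟩ - hpq
        refine Finsupp.filter_apply_neg _ _ fun ⟨b, hb⟩ => ?_
        have hρp := hρ p hp
        have hρq := hρ q hq
        have h1 := hsep q hq p hp (fun h => hpq (Subtype.ext h.symm)) (σ b) (by
          have := dist_triangle (σ b) (σ a) q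
          have := (hc.dist_le hσ b a).trans (hg ε hε).2
          nlinarith [hερ q hq])
        dsimp only at hb
        nlinarith
  have hrests : ∀ x ∈ chainSupp rest, x ∈ chainSupp c ∧ ∀ q ∈ Q, ρ q < dist x q := by
    intro x hx
    obtain ⟨σ, hσ, a, rfl⟩ := mem_chainSupp.1 hx
    exact ⟨mem_chainSupp.2 ⟨σ, (hrest σ hσ).1, a, rfl⟩, fun q hq => (hrest σ hσ).2 q hq a⟩
  refine ⟨rest + ∑ q : Q, f q, ?_, ?_, ?_, fun ε₂ hε₂ hεε₂ => ?_⟩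
  · exact fineLE_iff.2 (Submodule.add_mem _
      (fineLE_iff.1 fun σ hσ => (hc σ (hrest σ hσ).1).trans (hg ε hε).2)
      (Submodule.sum_mem _ fun q _ => fineLE_iff.1 (hff q)))
  · conv_rhs => rw [hsplit]
    simp only [map_add, map_sum, hfbd]
  · refine chainSupp_subset_iff.2 (Submodule.add_mem _
      (chainSupp_subset_iff.1 fun x hx => Or.inl (hrests x hx))
      (Submodule.sum_mem _ fun q _ => chainSupp_subset_iff.1 fun x hx => Or.inr ?_))
    exact ⟨q, q.2, hfs q x hx⟩
  · choose e hebd hef hes using fun q => hfe q ε₂ hε₂ hεε₂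
    refine ⟨∑ q : Q, e q, ?_, ?_, ?_⟩
    · conv_rhs => rw [hsplit]
      simp only [map_sum, hebd, Finset.sum_sub_distrib]
      abel
    · exact fineLE_iff.2 (Submodule.sum_mem _ fun q _ => fineLE_iff.1 (hef q))
    · exact chainSupp_subset_iff.2 (Submodule.sum_mem _ fun q _ =>
        chainSupp_subset_iff.1 fun x hx => ⟨q, q.2, hes q x hx⟩)

theorem iterate_pos_and_le {g : ℝ → ℝ} (hg : ∀ δ : ℝ, 0 < δ → 0 < g δ ∧ g δ ≤ δ) {δ : ℝ}
    (hδ : 0 < δ) (n : ℕ) : 0 < g^[n] δ ∧ g^[n] δ ≤ δ := by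
  induction n with
  | zero => exact ⟨hδ, le_rfl⟩
  | succ n ih =>
    rw [Function.iterate_succ_apply']
    exact ⟨(hg _ ih.1).1, (hg _ ih.1).2.trans ih.2⟩

/-- Detouring around the balls of radius greater than `u / K ^ t`, treating successively the
balls whose radii lie in `(u / K ^ (s + 1), u / K ^ s]`, for `s < t`. -/
theorem detour_large_balls {𝒮 : Type*} [MetricSpace 𝒮] {k : ℕ} {K : ℝ} (hK : 9 ≤ K)
    {g : ℝ → ℝ} (hg : ∀ δ : ℝ, 0 < δ → 0 < g δ ∧ g δ ≤ δ) {P : Set 𝒮} {r : 𝒮 → ℝ}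
    (hF1 : FillAnnuli k K g P r) (hF2 : FillBalls k K g P r) {ρ : 𝒮 → ℝ} (Q : Finset 𝒮)
    (hQP : ∀ q ∈ Q, q ∈ P) (hρr : ∀ q ∈ Q, 2 * K * ρ q ≤ r q / K)
    (hsep : ∀ p ∈ Q, ∀ q ∈ Q, p ≠ q → ρ p ≤ ρ q → ∀ x, dist x p ≤ 2 * K * ρ p →
      dist x q ≤ 2 * K * ρ q → ρ p ≤ ρ q / K ^ 4)
    {j : ℕ} (hj : j + 1 ≤ k) {δ : ℝ} (hδ : 0 < δ) (hδρ : ∀ q ∈ Q, δ ≤ ρ q) {u : ℝ} (hu : 0 ≤ u)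
    {m : ℕ} {d : DChain 𝒮 (j + 2)} (hd : FineLE (g^[m] δ) d)
    (hbd : ∀ q ∈ Q, ∀ x ∈ chainSupp (dbd d), ρ q < dist x q)
    (hlarge : ∀ q ∈ Q, u < ρ q → ∀ x ∈ chainSupp d, 2⁻¹ * ρ q ≤ dist x q)
    (t : ℕ) : ∀ s, s + t = m →
    ∃ c : DChain 𝒮 (j + 2), FineLE (g^[s] δ) c ∧ dbd c = dbd d ∧
      (∀ q ∈ Q, u / K ^ t < ρ q → ∀ x ∈ chainSupp c,
        ρ q / (2 * K) + 5 * K * min (u / K ^ t) (2 * ρ q / K ^ 4) < dist x q) ∧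
      (∀ x ∈ chainSupp c, ∃ y ∈ chainSupp d, dist x y ≤ 5 * K * (u - u / K ^ t)) ∧
      (∀ x ∈ chainSupp c, ∃ y ∈ chainSupp d, dist x y ≤ 3 * K * (√u - √(u / K ^ t))) ∧
      ∀ δ₂, 0 < δ₂ → δ = g δ₂ → ∃ e : DChain 𝒮 (j + 3), dbd e = d - c ∧ FineLE δ₂ e ∧
        ∀ x ∈ chainSupp e, ∃ y ∈ chainSupp d, dist x y ≤ (4 * K ^ 2 + 8 * K) * u := by
  have hK0 : 0 < K := by linarith
  have hρ : ∀ q ∈ Q, 0 < ρ q := fun q hq => hδ.trans_le (hδρ q hq)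
  have hsmall : ∀ q ∈ Q, ∀ v,
      ρ q / (2 * K) + 5 * K * min v (2 * ρ q / K ^ 4) < ρ q / K := by
    intro q hq v
    have h1 : 5 * K * min v (2 * ρ q / K ^ 4) ≤ 5 * K * (2 * ρ q / K ^ 4) := by
      gcongr; exact min_le_right _ _
    have h2 : 5 * K * (2 * ρ q / K ^ 4) = 20 / K ^ 2 * (ρ q / (2 * K)) := by
      field_simp; ring
    have h3 : 20 / K ^ 2 < 1 := by
      rw [div_lt_one (by positivity)]; nlinarith
    have h4 : 0 < ρ q / (2 * K) := div_pos (hρ q hq) (by positivity)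
    have h5 : ρ q / K = 2 * (ρ q / (2 * K)) := by field_simp
    nlinarith
  have hdivK : ∀ q ∈ Q, ρ q / K ≤ 2⁻¹ * ρ q := fun q hq => by
    rw [div_eq_inv_mul]
    have := hρ q hq
    gcongr
    linarith
  induction t with
  | zero =>
    rintro s rfl
    refine ⟨d, hd, rfl, fun q hq huq x hx => ?_, fun x hx => ⟨x, hx, by simp⟩,
      fun x hx => ⟨x, hx, by simp⟩, fun δ₂ _ _ => ⟨0, by simp, fineLE_zero _, by simp⟩⟩
    have := hlarge q hq (by simpa using huq) x hx
    linarith [hsmall q hq (u / K ^ 0), hdivK q hq]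
  | succ t ih =>
    intro s hs
    obtain ⟨c, hc, hcbd, hcav, hcs, hcs', hce⟩ := ih (s + 1) (by omega)
    have hu_succ : u / K ^ (t + 1) = u / K ^ t / K := by rw [pow_succ]; field_simp
    rw [hu_succ]
    have hv : 0 ≤ u / K ^ t := by positivity
    have hvu : u / K ^ t ≤ u := div_le_self hu (one_le_pow₀ (by linarith))
    set v := u / K ^ t
    have hvK : v / K ≤ v / 9 := by gcongr
    have hεle := iterate_pos_and_le hg hδ s
    let Q' := {q ∈ Q | v / K < ρ q ∧ ρ q ≤ v}
    have hQ' : ∀ q ∈ Q', q ∈ Q ∧ v / K < ρ q ∧ ρ q ≤ v := fun q hq => Finset.mem_filter.1 hq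
    have hfar : ∀ p ∈ Q', ∀ q ∈ Q', p ≠ q → ρ p ≤ ρ q → ∀ x, dist x p ≤ 2 * K * ρ p →
        2 * K * ρ q < dist x q := by
      intro p hp q hq hpq hle x hx
      by_contra! hxq
      obtain ⟨hp, hvp, hpv⟩ := hQ' p hp
      obtain ⟨hq, hvq, hqv⟩ := hQ' q hq
      have h1 := hsep p hp q hq hpq hle x hx hxq
      have h2 : ρ q / K ^ 4 ≤ v / K := by
        refine div_le_div₀ hv hqv hK0 (le_self_pow₀ (by linarith) (by norm_num))
      linarith
    have hfar' : ∀ p ∈ Q', ∀ q ∈ Q', p ≠ q → ∀ x, dist x p ≤ 2 * K * ρ p →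
        2 * K * ρ q < dist x q := by
      intro p hp q hq hpq x hx
      rcases le_total (ρ p) (ρ q) with hle | hle
      · exact hfar p hp q hq hpq hle x hx
      · by_contra! hxq
        exact (hfar q hq p hp hpq.symm hle x hxq).not_ge hx
    obtain ⟨c', hc', hcbd', hcs₁, hce₁⟩ := detour_separated_balls (by linarith) hg hF1 hF2 Q'
      (fun q hq => hQP q (hQ' q hq).1) (fun q hq => hρr q (hQ' q hq).1) hfar' hj hεle.1
      (fun q hq => hεle.2.trans (hδρ q (hQ' q hq).1))
      (by rwa [Function.iterate_succ_apply'] at hc)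
      (fun q hq x hx => hbd q (hQ' q hq).1 x (hcbd ▸ hx))
    have hmove : ∀ x, ∀ q ∈ Q', ∀ y, dist x q ≤ 2 * K * ρ q → dist y q ≤ ρ q →
        dist x y ≤ 4 * K * ρ q := by
      intro x q hq y hx hy
      have := dist_triangle_right x y q
      nlinarith [hρ q (hQ' q hq).1]
    refine ⟨c', hc', hcbd'.trans hcbd, ?_, ?_, ?_, ?_⟩
    · intro q hq hqv x hx
      have hρq := hρ q hq
      have hmin : min (v / K) (2 * ρ q / K ^ 4) ≤ min v (2 * ρ q / K ^ 4) :=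
        min_le_min_right _ (by linarith)
      by_cases hqQ' : q ∈ Q'
      · refine (hsmall q hq _).trans_le ?_
        have hle : ρ q / K ≤ ρ q := div_le_self hρq.le (by linarith)
        rcases hcs₁ x hx with ⟨-, h⟩ | ⟨p, hp, h1, h2, -⟩
        · exact hle.trans (h q hqQ').le
        · rcases eq_or_ne p q with rfl | hpq
          · exact h1
          · have := hfar' p hp q hqQ' hpq x h2
            nlinarith
      · have hvq : v < ρ q := by
          by_contra! h
          exact hqQ' (Finset.mem_filter.2 ⟨hq, hqv, h⟩)
        rcases hcs₁ x hx with ⟨h, -⟩ | ⟨p, hp, h1, h2, ⟨y, hy, hyp⟩, -⟩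
        · refine lt_of_le_of_lt ?_ (hcav q hq hvq x h)
          gcongr
        · by_contra! hxq
          obtain ⟨hpQ, hvp, hpv⟩ := hQ' p hp
          have hpq : p ≠ q := by rintro rfl; exact hqQ' hp
          have h3 := hcav q hq hvq y hy
          have h4 := hmove x p hp y h2 hyp
          have h5 := dist_triangle_left y q x
          have hxq' : dist x q ≤ 2 * K * ρ q := by
            have := hsmall q hq (v / K)
            have := hdivK q hq
            nlinarith
          have h6 := hsep p hpQ q hq hpq (by linarith) x h2 hxq'
          have h7 : 4 * ρ p + 5 * min (v / K) (2 * ρ q / K ^ 4) ≤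
              5 * min v (2 * ρ q / K ^ 4) := by
            have h8 := min_le_left (v / K) (2 * ρ q / K ^ 4)
            have h9 : 2 * ρ q / K ^ 4 = 2 * (ρ q / K ^ 4) := mul_div_assoc _ _ _
            rcases min_choice v (2 * ρ q / K ^ 4) with h | h <;> rw [h] <;> linarith
          nlinarith
    · intro x hx
      rcases hcs₁ x hx with ⟨h, -⟩ | ⟨p, hp, h1, h2, ⟨y, hy, hyp⟩, -⟩
      · obtain ⟨z, hz, hxz⟩ := hcs x h
        exact ⟨z, hz, hxz.trans (by gcongr; linarith)⟩
      · obtain ⟨z, hz, hyz⟩ := hcs y hy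
        refine ⟨z, hz, ?_⟩
        have h4 := hmove x p hp y h2 hyp
        have h5 := dist_triangle x y z
        obtain ⟨hpQ, hvp, hpv⟩ := hQ' p hp
        nlinarith
    · have hsq : √(v / K) ≤ √v / 3 := by
        refine Real.sqrt_le_iff.2 ⟨by positivity, ?_⟩
        rw [div_pow, Real.sq_sqrt hv]
        linarith
      have hsq0 := Real.sqrt_nonneg v
      intro x hx
      rcases hcs₁ x hx with ⟨h, -⟩ | ⟨p, hp, h1, h2, -, y, hy, hxy⟩
      · obtain ⟨z, hz, hxz⟩ := hcs' x h
        exact ⟨z, hz, hxz.trans (by gcongr; linarith)⟩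
      · obtain ⟨z, hz, hyz⟩ := hcs' y hy
        refine ⟨z, hz, ?_⟩
        have h5 := dist_triangle x y z
        have h6 := Real.sqrt_le_sqrt (hQ' p hp).2.2
        nlinarith
    · rintro δ₂ hδ₂ hδδ₂
      obtain ⟨e, hebd, hef, hes⟩ := hce δ₂ hδ₂ hδδ₂
      have hδ₂s := iterate_pos_and_le hg hδ₂ s
      obtain ⟨e', hebd', hef', hes'⟩ := hce₁ (g^[s] δ₂) hδ₂s.1 (by
        rw [hδδ₂, ← Function.iterate_succ_apply, Function.iterate_succ_apply'])
      refine ⟨e + e', by rw [map_add, hebd, hebd', sub_add_sub_cancel], ?_, ?_⟩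
      · exact fineLE_iff.2 (Submodule.add_mem _ (fineLE_iff.1 hef)
          (fineLE_iff.1 (hef'.mono hδ₂s.2)))
      · refine chainSupp_subset_iff.2 (Submodule.add_mem _ (chainSupp_subset_iff.1 hes)
          (chainSupp_subset_iff.1 fun x hx => ?_))
        obtain ⟨q, hq, hxq, y, hy, hyq⟩ := hes' x hx
        obtain ⟨z, hz, hyz⟩ := hcs y hy
        refine ⟨z, hz, ?_⟩
        have h1 := dist_triangle x y z
        have h2 := dist_triangle_right x y q
        have h3 : dist x q + dist y q ≤ (2 * K ^ 2 + 1) * u := by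
          have := (hQ' q hq).2.2.trans hvu
          nlinarith [sq_nonneg K]
        have h4 : 5 * K * (u - v) ≤ 5 * K * u := by gcongr; linarith
        nlinarith

/-- detouring around general families of balls.  In the ball-system setup
with the filling hypotheses (F1), (F2) and property (*): given `N ≥ 2K` and a nonempty
finite family `𝔹 ⊆ (1/N)𝔅` of balls `B(q, r_q/(N·M))`, `q ∈ Q`, set
`m := 1 + ⌊log_K(𝔯_max(𝔹)/𝔯_min(𝔹))⌋`.  Any `g^{(m)}(δ)`-fine discrete `i`-chain `d`
(`1 ≤ i ≤ k`, `0 < δ ≤ 𝔯_min(𝔹)`) with `supp(∂d)` disjoint from every ball of `𝔹` admits a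
discrete `i`-chain `d'` with:
(1) `d'` is `δ`-fine and `∂d' = ∂d`;
(2) `supp(d')` is disjoint from every ball of `(1/2K)𝔹`;
(3) `supp(d')` is contained in the closed `8K·𝔯_max(𝔹)`-neighbourhood of `supp(d)`;
(4) if `∂d ≠ 0` then `diam(d') ≤ diam(d) + 8K·√(2K·diam(d))`;
(5) if moreover `d` is `g^{(m+1)}(δ)`-fine, then `d - d' = ∂e` for a `δ`-fine `(i+1)`-chain
`e` supported in the closed `(4K²+8K)·𝔯_max(𝔹)`-neighbourhood of `supp(d)`. -/
theorem detour_general_balls {𝒮 : Type*} [MetricSpace 𝒮]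
    (k : ℕ) (hk : 1 ≤ k) (K : ℝ) (hK : 9 ≤ K)
    (g : ℝ → ℝ) (hg : ∀ δ : ℝ, 0 < δ → 0 < g δ ∧ g δ ≤ δ)
    (P : Set 𝒮) (r : 𝒮 → ℝ) (hr : ∀ p ∈ P, 0 < r p)
    (M : ℝ) (hM : 2 * K ^ 2 ≤ M)
    (hF1 : FillAnnuli k K g P r) (hF2 : FillBalls k K g P r)
    (hstar : ∀ p ∈ P, ∀ q ∈ P, p ≠ q → r p ≤ r q →
      ((Metric.closedBall p (r p / M)) ∩ (Metric.closedBall q (r q / M))).Nonempty →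
      r p / M ≤ (r q / M) / K ^ 4)
    (N : ℝ) (hN : 2 * K ≤ N)
    (Q : Finset 𝒮) (hQP : ↑Q ⊆ P) (hQne : Q.Nonempty)
    (m : ℕ)
    (hm : m = 1 + Nat.floor (Real.logb K
      (Q.sup' hQne (fun q => r q / (N * M)) / Q.inf' hQne (fun q => r q / (N * M)))))
    (i : ℕ) (hi1 : 1 ≤ i) (hik : i ≤ k)
    (δ : ℝ) (hδ0 : 0 < δ) (hδmin : δ ≤ Q.inf' hQne (fun q => r q / (N * M)))
    (d : DChain 𝒮 (i + 1)) (hdfine : FineLE (g^[m] δ) d)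
    (hbd : ∀ q ∈ Q, ∀ x ∈ chainSupp (dbd d), x ∉ Metric.closedBall q (r q / (N * M))) :
    ∃ d' : DChain 𝒮 (i + 1),
      FineLE δ d' ∧ dbd d' = dbd d ∧
      (∀ q ∈ Q, ∀ x ∈ chainSupp d', x ∉ Metric.closedBall q ((r q / (N * M)) / (2 * K))) ∧
      chainSupp d' ⊆ closedNbhd (8 * K * Q.sup' hQne (fun q => r q / (N * M)))
        (chainSupp d) ∧
      (dbd d ≠ 0 → Metric.diam (chainSupp d') ≤ Metric.diam (chainSupp d)
        + 8 * K * Real.sqrt (2 * K * Metric.diam (chainSupp d))) ∧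
      (FineLE (g^[m + 1] δ) d →
        ∃ e : DChain 𝒮 (i + 2), dbd e = d - d' ∧ FineLE δ e ∧
          chainSupp e ⊆ closedNbhd ((4 * K ^ 2 + 8 * K) * Q.sup' hQne
            (fun q => r q / (N * M))) (chainSupp d)) := by
  have hK0 : 0 < K := by linarith
  have hM0 : 0 < M := by nlinarith
  have hN0 : 0 < N := by linarith
  obtain ⟨j, rfl⟩ : ∃ j, i = j + 1 := ⟨i - 1, by omega⟩
  set ρ : 𝒮 → ℝ := fun q => r q / (N * M) with hρ_def
  set S := Q.sup' hQne ρ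
  set I := Q.inf' hQne ρ
  have hρ : ∀ q ∈ Q, 0 < ρ q := fun q hq => div_pos (hr q (hQP hq)) (by positivity)
  have hI : ∀ q ∈ Q, I ≤ ρ q := fun q hq => Finset.inf'_le ρ hq
  have hS : ∀ q ∈ Q, ρ q ≤ S := fun q hq => Finset.le_sup' ρ hq
  have hI0 : 0 < I := (Finset.lt_inf'_iff hQne).2 hρ
  have hS0 : 0 < S := by
    obtain ⟨q, hq⟩ := hQne
    exact (hρ q hq).trans_le (hS q hq)
  have hrM : ∀ q, r q / M = N * ρ q := fun q => by
    simp only [hρ_def]; field_simp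
  have hρr : ∀ q ∈ Q, 2 * K * ρ q ≤ r q / K := by
    intro q hq
    have h1 : r q = N * M * ρ q := by simp only [hρ_def]; field_simp
    rw [le_div_iff₀ hK0, h1]
    have h2 : 2 * K * K ≤ N * M := by nlinarith
    nlinarith [hρ q hq]
  have hsep : ∀ p ∈ Q, ∀ q ∈ Q, p ≠ q → ρ p ≤ ρ q → ∀ x, dist x p ≤ 2 * K * ρ p →
      dist x q ≤ 2 * K * ρ q → ρ p ≤ ρ q / K ^ 4 := by
    intro p hp q hq hpq hle x hxp hxq
    have h1 := hstar p (hQP hp) q (hQP hq) hpq ((div_le_div_iff_of_pos_right (by positivity)).1 hle)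
    simp only [hrM] at h1
    have h2 := h1 ⟨x, Metric.mem_closedBall.2 (hxp.trans (by gcongr; exact (hρ p hp).le)),
      Metric.mem_closedBall.2 (hxq.trans (by gcongr; exact (hρ q hq).le))⟩
    rw [mul_div_assoc] at h2
    exact le_of_mul_le_mul_left h2 hN0
  have hSm : ∀ q ∈ Q, S / K ^ m < ρ q := by
    intro q hq
    have h1 : Real.logb K (S / I) < (m : ℝ) := by
      rw [hm, add_comm 1]
      push_cast
      exact Nat.lt_floor_add_one _
    rw [Real.logb_lt_iff_lt_rpow (by linarith) (by positivity), Real.rpow_natCast,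
      div_lt_iff₀ hI0] at h1
    rw [div_lt_iff₀ (by positivity), mul_comm]
    exact h1.trans_le (by gcongr; exact hI q hq)
  obtain ⟨η, hη0, hηδ, hηd, hη⟩ : ∃ η, 0 < η ∧ η ≤ δ ∧ FineLE (g^[m] η) d ∧
      (FineLE (g^[m + 1] δ) d → η = g δ) := by
    by_cases h : FineLE (g^[m + 1] δ) d
    · exact ⟨g δ, (hg δ hδ0).1, (hg δ hδ0).2, h, fun _ => rfl⟩
    · exact ⟨δ, hδ0, le_rfl, hdfine, fun h' => absurd h' h⟩
  have hbd' : ∀ q ∈ Q, ∀ x ∈ chainSupp (dbd d), ρ q < dist x q := fun q hq x hx =>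
    not_le.1 (hbd q hq x hx)
  obtain ⟨u, hu0, huS, hudiam, hlarge⟩ : ∃ u, 0 ≤ u ∧ u ≤ S ∧
      (dbd d ≠ 0 → u ≤ 2 * Metric.diam (chainSupp d)) ∧
      ∀ q ∈ Q, u < ρ q → ∀ x ∈ chainSupp d, 2⁻¹ * ρ q ≤ dist x q := by
    by_cases h0 : dbd d = 0
    · exact ⟨S, hS0.le, le_rfl, fun h => absurd h0 h, fun q hq h => absurd (hS q hq) h.not_ge⟩
    refine ⟨min S (2 * Metric.diam (chainSupp d)),
      le_min hS0.le (mul_nonneg zero_le_two Metric.diam_nonneg), min_le_left _ _,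
      fun _ => min_le_right _ _, fun q hq hlt x hx => ?_⟩
    have hlt' : 2 * Metric.diam (chainSupp d) < ρ q :=
      (min_lt_iff.1 hlt).resolve_left (hS q hq).not_gt
    obtain ⟨τ, hτ⟩ := Finsupp.support_nonempty_iff.2 h0
    have hz : τ 0 ∈ chainSupp (dbd d) := mem_chainSupp.2 ⟨τ, hτ, 0, rfl⟩
    have h1 := hbd' q hq _ hz
    have h2 := Metric.dist_le_diam_of_mem (chainSupp_finite d).isBounded
      (chainSupp_dbd_subset d hz) hx
    linarith [dist_triangle (τ 0) x q]
  obtain ⟨d', hfine, hd'bd, hav, hnb, hnb', hfill⟩ := detour_large_balls hK hg hF1 hF2 Q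
    (fun q hq => hQP hq) hρr hsep hik hη0 (fun q hq => hηδ.trans (hδmin.trans (hI q hq))) hu0
    hηd hbd' hlarge m 0 (zero_add m)
  have hum : 0 ≤ u / K ^ m := by positivity
  refine ⟨d', hfine.mono hηδ, hd'bd, fun q hq x hx hxq => ?_, fun x hx => ?_, fun h0 => ?_,
    fun hd => ?_⟩
  · have h1 := hav q hq (lt_of_le_of_lt (by gcongr) (hSm q hq)) x hx
    have h2 : 0 ≤ 5 * K * min (u / K ^ m) (2 * ρ q / K ^ 4) :=
      mul_nonneg (by positivity)
        (le_min hum (div_nonneg (by linarith [hρ q hq]) (by positivity)))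
    linarith [Metric.mem_closedBall.1 hxq]
  · obtain ⟨y, hy, hxy⟩ := hnb x hx
    refine ⟨y, hy, hxy.trans ?_⟩
    calc 5 * K * (u - u / K ^ m) ≤ 5 * K * S := by gcongr; linarith
      _ ≤ 8 * K * S := by gcongr; norm_num
  · have hD := Metric.diam_nonneg (s := chainSupp d)
    have hle : √u ≤ √(2 * K * Metric.diam (chainSupp d)) :=
      Real.sqrt_le_sqrt ((hudiam h0).trans (by gcongr; linarith))
    refine Metric.diam_le_of_forall_dist_le (by positivity) fun a ha b hb => ?_
    obtain ⟨y, hy, hay⟩ := hnb' a ha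
    obtain ⟨z, hz, hbz⟩ := hnb' b hb
    have h1 := Metric.dist_le_diam_of_mem (chainSupp_finite d).isBounded hy hz
    have h2 := dist_triangle4_right a b y z
    have h3 : 3 * K * (√u - √(u / K ^ m)) ≤ 3 * K * √(2 * K * Metric.diam (chainSupp d)) := by
      gcongr
      linarith [Real.sqrt_nonneg (u / K ^ m)]
    have h4 := Real.sqrt_nonneg (2 * K * Metric.diam (chainSupp d))
    nlinarith
  · obtain ⟨e, he, hef, hes⟩ := hfill δ hδ0 (hη hd)
    refine ⟨e, he, hef, fun x hx => ?_⟩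
    obtain ⟨y, hy, hxy⟩ := hes x hx
    exact ⟨y, hy, hxy.trans (by gcongr)⟩
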